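/- arXiv:1305.1072 — 7 statements merged into one kernel-verified Lean document; each statement's English description precedes it below -/
import Mathlib

section
/- Let P be a hereditary property of graphs that contains at least one graph of every order n ≥ 1. Then the limit π(P) = lim_{n→∞} ex(P,n) / C(n,2) exists, i.e., the sequence n ↦ ex(P,n)/C(n,2) converges to some real number as n → ∞. -/
open Filter

/-- A family of finite simple graphs, given by the set of its members of each order `n`
(a member of order `n` is a graph on the vertex set `Fin n`). -/
abbrev GraphFamily := ∀ n : ℕ, Set (SimpleGraph (Fin n))

/-- A family of graphs is hereditary if it is closed under taking induced subgraphs. -/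
def IsHereditary (P : GraphFamily) : Prop :=
  ∀ ⦃m n : ℕ⦄ (f : Fin m ↪ Fin n) ⦃G : SimpleGraph (Fin n)⦄,
    G ∈ P n → G.comap f ∈ P m

/-- The number of edges of a graph. -/
noncomputable def edgeCount {n : ℕ} (G : SimpleGraph (Fin n)) : ℕ :=
  G.edgeSet.ncard

/-- `exP P n` is the maximum number of edges of a graph of order `n` belonging to `P`. -/
noncomputable def exP (P : GraphFamily) (n : ℕ) : ℕ :=
  sSup {m | ∃ G ∈ P n, edgeCount G = m}

open Classical in
/-- `quadSum G x = 2 * ∑_{{u,v} ∈ E(G)} x_u * x_v`. -/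
noncomputable def quadSum {n : ℕ} (G : SimpleGraph (Fin n)) (x : Fin n → ℝ) : ℝ :=
  ∑ u, ∑ v, if G.Adj u v then x u * x v else 0

/-- `λ^(α)(G)`: the maximum of `2∑_{{u,v}∈E(G)} x_u x_v` over real vectors `x`
with `∑ |x_i|^α = 1`. -/
noncomputable def lambdaA (α : ℝ) {n : ℕ} (G : SimpleGraph (Fin n)) : ℝ :=
  sSup {y | ∃ x : Fin n → ℝ, (∑ i, |x i| ^ α) = 1 ∧ y = quadSum G x}

/-- `λ^(α)(P, n)`: the maximum of `λ^(α)(G)` over graphs `G` of order `n` in `P`. -/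
noncomputable def lambdaP (α : ℝ) (P : GraphFamily) (n : ℕ) : ℝ :=
  sSup {y | ∃ G ∈ P n, y = lambdaA α G}

/-- `H` is isomorphic to an induced subgraph of `G`. -/
def IsInducedSubgraph {V W : Type*} (H : SimpleGraph V) (G : SimpleGraph W) : Prop :=
  ∃ f : V ↪ W, ∀ u v, G.Adj (f u) (f v) ↔ H.Adj u v

/-- `H` is isomorphic to a (not necessarily induced) subgraph of `G`. -/
def IsSubgraphOf {V W : Type*} (H : SimpleGraph V) (G : SimpleGraph W) : Prop :=
  ∃ f : V ↪ W, ∀ u v, H.Adj u v → G.Adj (f u) (f v)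

/-- `Her F`: the family of all graphs containing no member of `F` (of order ≥ 1)
as an induced subgraph. -/
def Her (F : GraphFamily) : GraphFamily :=
  fun _ => {G | ∀ m, 1 ≤ m → ∀ H ∈ F m, ¬ IsInducedSubgraph H G}

/-- A family of graphs is infinite iff it contains graphs of infinitely many orders
(each order carries only finitely many graphs). -/
def FamInfinite (P : GraphFamily) : Prop := {n | (P n).Nonempty}.Infinite

/-- `G` is a complete `r`-partite graph: its vertex set splits into `r` nonempty
independent parts, with all edges present between distinct parts. -/
def IsCompletePartite (r : ℕ) {n : ℕ} (G : SimpleGraph (Fin n)) : Prop :=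
  ∃ c : Fin n → Fin r, Function.Surjective c ∧ ∀ u v, G.Adj u v ↔ c u ≠ c v

/-- `ω̲(F)`: the least `r ≥ 1` with `K_r ∈ F`, or `0` (`= sInf ∅`) if `F` contains
no complete graph. -/
noncomputable def omegaLow (F : GraphFamily) : ℕ :=
  sInf {r | 1 ≤ r ∧ (⊤ : SimpleGraph (Fin r)) ∈ F r}

/-- `β(F)`: the least `r ≥ 1` such that `F` contains a complete `r`-partite graph,
or `0` (`= sInf ∅`) if `F` contains no complete multipartite graph. -/
noncomputable def betaF (F : GraphFamily) : ℕ :=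
  sInf {r | 1 ≤ r ∧ ∃ n, ∃ G ∈ F n, IsCompletePartite r G}

open Classical in
lemma edgeCount_eq_card {n : ℕ} (G : SimpleGraph (Fin n)) :
    edgeCount G = G.edgeFinset.card := by
  rw [edgeCount, ← SimpleGraph.coe_edgeFinset, Set.ncard_coe_finset]

lemma edgeCount_le_choose_two {n : ℕ} (G : SimpleGraph (Fin n)) :
    edgeCount G ≤ n.choose 2 := by
  classical
  rw [edgeCount_eq_card]
  simpa using G.card_edgeFinset_le_card_choose_two

lemma bddAbove_edgeCount (P : GraphFamily) (n : ℕ) :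
    BddAbove {m | ∃ G ∈ P n, edgeCount G = m} := by
  refine ⟨n.choose 2, ?_⟩
  rintro _ ⟨G, -, rfl⟩
  exact edgeCount_le_choose_two G

lemma edgeCount_le_exP {P : GraphFamily} {n : ℕ} {G : SimpleGraph (Fin n)} (hG : G ∈ P n) :
    edgeCount G ≤ exP P n :=
  le_csSup (bddAbove_edgeCount P n) ⟨G, hG, rfl⟩

lemma exists_edgeCount_eq_exP {P : GraphFamily} {n : ℕ} (hne : (P n).Nonempty) :
    ∃ G ∈ P n, edgeCount G = exP P n :=
  Nat.sSup_mem (hne.image edgeCount) (bddAbove_edgeCount P n)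

open Classical in
lemma edgeCount_comap_succAbove_add_degree {n : ℕ} (G : SimpleGraph (Fin (n + 1)))
    (i : Fin (n + 1)) :
    edgeCount (G.comap i.succAboveEmb) + G.degree i = edgeCount G := by
  let e : G.comap i.succAboveEmb ≃g G.induce {i}ᶜ :=
    ⟨finSuccAboveEquiv i, Iff.rfl⟩
  have hle : G.degree i ≤ G.edgeFinset.card := by
    rw [← G.card_incidenceFinset_eq_degree]
    exact Finset.card_le_card (G.incidenceFinset_subset i)
  have he : edgeCount (G.comap i.succAboveEmb) = (G.induce {i}ᶜ).edgeFinset.card := by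
    rw [edgeCount_eq_card]
    convert! e.card_edgeFinset_eq
  rw [he, edgeCount_eq_card,
    G.card_edgeFinset_induce_compl_singleton, G.card_edgeFinset_deleteIncidenceSet,
    Nat.sub_add_cancel hle]

lemma sum_edgeCount_comap_succAbove {n : ℕ} (G : SimpleGraph (Fin (n + 1))) :
    ∑ i : Fin (n + 1), edgeCount (G.comap i.succAboveEmb) + 2 * edgeCount G =
      (n + 1) * edgeCount G := by
  classical
  have h := G.sum_degrees_eq_twice_card_edges
  rw [← edgeCount_eq_card] at h
  rw [← h, ← Finset.sum_add_distrib,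
    Finset.sum_congr rfl fun i _ ↦ edgeCount_comap_succAbove_add_degree G i]
  simp

lemma mul_exP_succ_le {P : GraphFamily} (hP : IsHereditary P) {n : ℕ}
    (hne : (P (n + 1)).Nonempty) :
    (n + 1) * exP P (n + 1) ≤ (n + 1) * exP P n + 2 * exP P (n + 1) := by
  obtain ⟨G, hG, hGe⟩ := exists_edgeCount_eq_exP hne
  rw [← hGe, ← sum_edgeCount_comap_succAbove]
  gcongr
  simpa using Finset.sum_le_card_nsmul Finset.univ
    (fun i : Fin (n + 1) ↦ edgeCount (G.comap i.succAboveEmb)) (exP P n)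
    fun i _ ↦ edgeCount_le_exP (hP i.succAboveEmb hG)

/-- The Katona–Nemetz–Simonovits averaging argument for hereditary properties. -/
lemma antitoneOn_exP_div_choose_two {P : GraphFamily} (hP : IsHereditary P)
    (hne : ∀ n : ℕ, 1 ≤ n → (P n).Nonempty) :
    AntitoneOn (fun n : ℕ ↦ (exP P n : ℝ) / (n.choose 2 : ℝ)) (Set.Ici 2) := by
  apply antitoneOn_nat_Ici_of_succ_le
  intro n hn
  have h : ((n : ℝ) + 1) * exP P (n + 1) ≤ (n + 1) * exP P n + 2 * exP P (n + 1) :=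
    mod_cast mul_exP_succ_le hP (hne (n + 1) (by omega))
  have hn' : (2 : ℝ) ≤ n := mod_cast hn
  rw [div_le_div_iff₀ (mod_cast Nat.choose_pos (by omega)) (mod_cast Nat.choose_pos hn),
    Nat.cast_choose_two, Nat.cast_choose_two]
  push_cast
  nlinarith

/-- For a hereditary property `P` of graphs containing at least one graph
of every order `n ≥ 1`, the limit `π(P) = lim_{n→∞} ex(P,n) / C(n,2)` exists. -/
theorem exP_div_choose_tendsto (P : GraphFamily) (hP : IsHereditary P)
    (hne : ∀ n : ℕ, 1 ≤ n → (P n).Nonempty) :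
    ∃ L : ℝ, Tendsto (fun n : ℕ => (exP P n : ℝ) / (n.choose 2 : ℝ)) atTop (nhds L) := by
  refine ⟨_, Real.tendsto_atTop_csInf_of_antitoneOn_bddBelow_nat_Ici
    (antitoneOn_exP_div_choose_two hP hne) ⟨0, ?_⟩⟩
  rintro _ ⟨n, -, rfl⟩
  positivity
end

section
/- Let α ≥ 1 be a real number and let P be a hereditary property of graphs that contains at least one graph of every order n ≥ 1. Then the limit λ^(α)(P) = lim_{n→∞} λ^(α)(P,n) · n^{(2/α) - 2} exists, where λ^(α)(P,n) = max{λ^(α)(G) : G ∈ P and G has n vertices}. -/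
open Filter

open Finset in
theorem quadSum_succAbove {m : ℕ} (G : SimpleGraph (Fin (m + 1))) (k : Fin (m + 1))
    (z : Fin (m + 1) → ℝ) :
    ∃ d : ℝ, ∀ t : ℝ, quadSum G (Function.update z k t) =
      quadSum (G.comap k.succAboveEmb) (z ∘ k.succAbove) + t * d := by
  classical
  refine ⟨2 * ∑ j, if G.Adj k (k.succAbove j) then z (k.succAbove j) else 0, fun t => ?_⟩
  have hcomm : ∀ j, G.Adj (k.succAbove j) k ↔ G.Adj k (k.succAbove j) :=
    fun j => G.adj_comm _ _
  unfold quadSum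
  simp only [Fin.sum_univ_succAbove _ k, Function.update_self, SimpleGraph.irrefl, if_false,
    Function.update_of_ne (Fin.succAbove_ne k _), sum_add_distrib, hcomm,
    SimpleGraph.comap_adj, Fin.coe_succAboveEmb, Function.comp_apply]
  have h₁ : ∀ j, (if G.Adj k (k.succAbove j) then t * z (k.succAbove j) else 0) =
      t * (if G.Adj k (k.succAbove j) then z (k.succAbove j) else 0) := by
    intro j; split_ifs <;> simp
  have h₂ : ∀ j, (if G.Adj k (k.succAbove j) then z (k.succAbove j) * t else 0) =
      t * (if G.Adj k (k.succAbove j) then z (k.succAbove j) else 0) := by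
    intro j; split_ifs <;> ring
  simp only [h₁, h₂, ← mul_sum]
  ring

theorem continuous_quadSum {n : ℕ} (G : SimpleGraph (Fin n)) : Continuous (quadSum G) := by
  classical
  unfold quadSum
  refine continuous_finsetSum _ fun u _ => continuous_finsetSum _ fun v _ => ?_
  split_ifs <;> fun_prop

theorem quadSum_const_mul {n : ℕ} (G : SimpleGraph (Fin n)) (c : ℝ) (x : Fin n → ℝ) :
    quadSum G (fun i => c * x i) = c ^ 2 * quadSum G x := by
  classical
  unfold quadSum
  simp only [Finset.mul_sum]
  refine Finset.sum_congr rfl fun u _ => Finset.sum_congr rfl fun v _ => ?_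
  split_ifs <;> ring

theorem quadSum_zero {n : ℕ} (G : SimpleGraph (Fin n)) : quadSum G 0 = 0 := by
  simp [quadSum]

theorem sum_abs_single_rpow {n : ℕ} {α : ℝ} (hα : 0 < α) (k : Fin n) :
    ∑ i, |(Pi.single k 1 : Fin n → ℝ) i| ^ α = 1 := by
  rw [Finset.sum_eq_single k]
  · simp
  · intro i _ hi
    simp [hi, Real.zero_rpow hα.ne']
  · simp

theorem isCompact_sum_abs_rpow_eq_one {n : ℕ} {α : ℝ} (hα : 0 < α) :
    IsCompact {x : Fin n → ℝ | ∑ i, |x i| ^ α = 1} := by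
  refine Metric.isCompact_of_isClosed_isBounded ?_ ?_
  · refine isClosed_eq (continuous_finsetSum _ fun i _ => ?_) continuous_const
    exact (continuous_abs.comp (continuous_apply i)).rpow_const fun _ => Or.inr hα.le
  · refine Metric.isBounded_closedBall (x := (0 : Fin n → ℝ)) (r := 1) |>.subset fun x hx => ?_
    rw [mem_closedBall_zero_iff, pi_norm_le_iff_of_nonneg zero_le_one]
    intro i
    rw [Real.norm_eq_abs]
    by_contra! hi
    have hle : |x i| ^ α ≤ ∑ i, |x i| ^ α :=
      Finset.single_le_sum (f := fun i => |x i| ^ α)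
        (fun j _ => Real.rpow_nonneg (abs_nonneg _) _) (Finset.mem_univ i)
    have : 1 < |x i| ^ α := Real.one_lt_rpow hi hα
    rw [hx] at hle
    linarith

theorem exists_quadSum_eq_lambdaA {n : ℕ} {α : ℝ} (hα : 0 < α) (hn : 0 < n)
    (G : SimpleGraph (Fin n)) :
    ∃ x : Fin n → ℝ, ∑ i, |x i| ^ α = 1 ∧ quadSum G x = lambdaA α G ∧
      ∀ z : Fin n → ℝ, ∑ i, |z i| ^ α = 1 → quadSum G z ≤ lambdaA α G := by
  obtain ⟨x, hx, hmax⟩ := (isCompact_sum_abs_rpow_eq_one (n := n) hα).exists_isMaxOn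
    ⟨_, sum_abs_single_rpow hα ⟨0, hn⟩⟩ (continuous_quadSum G).continuousOn
  have hg : IsGreatest {y | ∃ x : Fin n → ℝ, (∑ i, |x i| ^ α) = 1 ∧ y = quadSum G x}
      (quadSum G x) := by
    refine ⟨⟨x, hx, rfl⟩, ?_⟩
    rintro _ ⟨z, hz, rfl⟩
    exact hmax hz
  have he : lambdaA α G = quadSum G x := hg.csSup_eq
  exact ⟨x, hx, he.symm, fun z hz => he ▸ hmax hz⟩

theorem lambdaA_nonneg {n : ℕ} {α : ℝ} (hα : 0 < α) (hn : 0 < n) (G : SimpleGraph (Fin n)) :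
    0 ≤ lambdaA α G := by
  classical
  obtain ⟨x, -, -, h⟩ := exists_quadSum_eq_lambdaA hα hn G
  refine le_trans (le_of_eq ?_) (h _ (sum_abs_single_rpow hα ⟨0, hn⟩))
  unfold quadSum
  refine (Finset.sum_eq_zero fun u _ => Finset.sum_eq_zero fun v _ => ?_).symm
  split_ifs with huv
  · by_cases hu : u = ⟨0, hn⟩
    · subst hu
      simp [huv.ne']
    · simp [hu]
  · rfl

theorem quadSum_le_lambdaA_mul {n : ℕ} {α : ℝ} (hα : 0 < α) (hn : 0 < n)
    (G : SimpleGraph (Fin n)) (z : Fin n → ℝ) :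
    quadSum G z ≤ lambdaA α G * (∑ i, |z i| ^ α) ^ (2 / α) := by
  obtain ⟨-, -, -, h⟩ := exists_quadSum_eq_lambdaA hα hn G
  have hnn : ∀ i ∈ Finset.univ, 0 ≤ |z i| ^ α := fun i _ => Real.rpow_nonneg (abs_nonneg _) _
  rcases (Finset.sum_nonneg hnn).eq_or_lt with hS | hS
  · have hz : z = 0 := by
      funext i
      have := (Finset.sum_eq_zero_iff_of_nonneg hnn).1 hS.symm i (Finset.mem_univ i)
      rw [Real.rpow_eq_zero (abs_nonneg _) hα.ne'] at this
      simpa using this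
    rw [← hS, Real.zero_rpow (by positivity), hz, quadSum_zero, mul_zero]
  · set S := ∑ i, |z i| ^ α with hSdef
    set c := S ^ (1 / α) with hc
    have hcpos : 0 < c := Real.rpow_pos_of_pos hS _
    have hcα : c ^ α = S := by
      rw [hc, ← Real.rpow_mul hS.le, one_div_mul_cancel hα.ne', Real.rpow_one]
    have hc2 : c ^ 2 = S ^ (2 / α) := by
      rw [hc, ← Real.rpow_natCast, ← Real.rpow_mul hS.le]
      congr 1
      push_cast
      ring
    have hle := h (fun i => c⁻¹ * z i) (by
      have : ∀ i, |c⁻¹ * z i| ^ α = S⁻¹ * |z i| ^ α := by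
        intro i
        rw [abs_mul, Real.mul_rpow (abs_nonneg _) (abs_nonneg _), abs_of_pos (inv_pos.2 hcpos),
          Real.inv_rpow hcpos.le, hcα]
      simp only [this, ← Finset.mul_sum]
      exact inv_mul_cancel₀ hS.ne')
    rw [quadSum_const_mul] at hle
    rw [← hc2]
    calc quadSum G z = (c⁻¹ ^ 2 * quadSum G z) * c ^ 2 := by field_simp
      _ ≤ lambdaA α G * c ^ 2 := by gcongr

/-- Deleting the vertex `k` from an extremal vector `x` removes the proportion `2 * |x k| ^ α`
of its value. -/
theorem quadSum_comap_succAbove_of_extremal {m : ℕ} {α : ℝ} (hα : 0 < α)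
    (G : SimpleGraph (Fin (m + 1))) {x : Fin (m + 1) → ℝ} (hx : ∑ i, |x i| ^ α = 1)
    (hmax : quadSum G x = lambdaA α G) (k : Fin (m + 1)) :
    quadSum (G.comap k.succAboveEmb) (x ∘ k.succAbove) =
      lambdaA α G * (1 - 2 * |x k| ^ α) := by
  obtain ⟨d, hd⟩ := quadSum_succAbove G k x
  set A := quadSum (G.comap k.succAboveEmb) (x ∘ k.succAbove)
  set l := lambdaA α G
  set y := |x k| ^ α with hy
  have htot : A + x k * d = l := by
    rw [← hd, Function.update_eq_self, hmax]
  have hle : ∀ t : ℝ, 0 < t → A + t * (x k * d) ≤ l * (1 - y + t ^ α * y) ^ (2 / α) := by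
    intro t ht
    have := quadSum_le_lambdaA_mul hα m.succ_pos G (Function.update x k (t * x k))
    rw [hd] at this
    rw [Fin.sum_univ_succAbove _ k] at this hx
    simp only [Function.update_self, Function.update_of_ne (Fin.succAbove_ne k _), abs_mul,
      abs_of_pos ht, Real.mul_rpow ht.le (abs_nonneg _)] at this
    rw [← hy] at this hx
    rw [show ∑ i, |x (k.succAbove i)| ^ α = 1 - y by linarith, add_comm (t ^ α * y)] at this
    linarith
  have hderiv : HasDerivAt
      (fun t : ℝ => l * (1 - y + t ^ α * y) ^ (2 / α) - (A + t * (x k * d)))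
      (2 * l * y - x k * d) 1 := by
    have h₁ := (((Real.hasDerivAt_rpow_const (x := 1) (p := α)
      (Or.inl one_ne_zero)).mul_const y).const_add (1 - y)).rpow_const (p := 2 / α)
      (Or.inl (by simp))
    have h₂ := (h₁.const_mul l).sub
      (((hasDerivAt_id (1 : ℝ)).mul_const (x k * d)).const_add A)
    refine HasDerivAt.congr_deriv h₂ ?_
    simp
    field_simp
  have hmin : IsLocalMin
      (fun t : ℝ => l * (1 - y + t ^ α * y) ^ (2 / α) - (A + t * (x k * d))) 1 := by
    filter_upwards [lt_mem_nhds (zero_lt_one (α := ℝ))] with t ht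
    have := hle t ht
    simp only [Real.one_rpow, one_mul, sub_add_cancel, mul_one, htot, sub_self]
    linarith
  have := hmin.hasDerivAt_eq_zero hderiv
  linarith

theorem one_sub_two_mul_mul_rpow_le {p s y : ℝ} (hp : p ≤ 2) (hy : 0 ≤ y) (hys : y ≤ s)
    (hs : s ≤ 1 / 2) : (1 - 2 * s) * (1 - y) ^ p ≤ (1 - 2 * y) * (1 - s) ^ p := by
  have h₁ : 0 < 1 - s := by linarith
  have h₂ : 0 < 1 - y := by linarith
  have hr : ((1 - y) / (1 - s)) ^ p ≤ ((1 - y) / (1 - s)) ^ 2 := by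
    rw [← Real.rpow_two]
    exact Real.rpow_le_rpow_of_exponent_le ((one_le_div h₁).2 (by linarith)) hp
  rw [Real.div_rpow h₂.le h₁.le, div_pow,
    div_le_iff₀ (Real.rpow_pos_of_pos h₁ p)] at hr
  have hpoly : (1 - 2 * s) * ((1 - y) ^ 2 / (1 - s) ^ 2) ≤ 1 - 2 * y := by
    rw [← mul_div_assoc, div_le_iff₀ (by positivity)]
    nlinarith [mul_nonneg (sub_nonneg.2 hys)
      (show 0 ≤ s + y - 2 * s * y by nlinarith)]
  calc (1 - 2 * s) * (1 - y) ^ p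
      ≤ (1 - 2 * s) * ((1 - y) ^ 2 / (1 - s) ^ 2 * (1 - s) ^ p) :=
        mul_le_mul_of_nonneg_left hr (by linarith)
    _ = (1 - 2 * s) * ((1 - y) ^ 2 / (1 - s) ^ 2) * (1 - s) ^ p := by ring
    _ ≤ (1 - 2 * y) * (1 - s) ^ p :=
        mul_le_mul_of_nonneg_right hpoly (Real.rpow_nonneg h₁.le _)

theorem exists_comap_lambdaA_mul_le {m : ℕ} (hm : 1 ≤ m) {α : ℝ} (hα : 1 ≤ α)
    (G : SimpleGraph (Fin (m + 1))) :
    ∃ k : Fin (m + 1), lambdaA α G * (1 - 2 * (1 / ((m : ℝ) + 1))) ≤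
      lambdaA α (G.comap k.succAboveEmb) * (1 - 1 / ((m : ℝ) + 1)) ^ (2 / α) := by
  have hα0 : 0 < α := by linarith
  obtain ⟨x, hx, hmax, -⟩ := exists_quadSum_eq_lambdaA hα0 m.succ_pos G
  obtain ⟨k, -, hk⟩ : ∃ k ∈ Finset.univ, |x k| ^ α ≤ 1 / ((m : ℝ) + 1) := by
    refine Finset.exists_le_of_sum_le Finset.univ_nonempty ?_
    rw [hx]
    simp
    field_simp
    rfl
  refine ⟨k, ?_⟩
  have hle := quadSum_le_lambdaA_mul hα0 hm (G.comap k.succAboveEmb) (x ∘ k.succAbove)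
  rw [quadSum_comap_succAbove_of_extremal hα0 G hx hmax k] at hle
  rw [Fin.sum_univ_succAbove _ k] at hx
  have hsum : ∑ i, |(x ∘ k.succAbove) i| ^ α = 1 - |x k| ^ α := by
    change ∑ i, |x (k.succAbove i)| ^ α = 1 - |x k| ^ α
    linarith
  rw [hsum] at hle
  set y := |x k| ^ α
  set s := 1 / ((m : ℝ) + 1) with hs
  have hm' : (1 : ℝ) ≤ m := by exact_mod_cast hm
  have hs2 : s ≤ 1 / 2 := by
    rw [hs]
    exact one_div_le_one_div_of_le two_pos (by linarith)
  have hy0 : 0 ≤ y := Real.rpow_nonneg (abs_nonneg _) _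
  have hp : 2 / α ≤ 2 := div_le_self zero_le_two hα
  have hypos : 0 < (1 - y) ^ (2 / α) := Real.rpow_pos_of_pos (by linarith) _
  have hspos : 0 ≤ (1 - s) ^ (2 / α) := Real.rpow_nonneg (by linarith) _
  have hineq := mul_le_mul_of_nonneg_left (one_sub_two_mul_mul_rpow_le hp hy0 hk hs2)
    (lambdaA_nonneg hα0 m.succ_pos G)
  refine le_of_mul_le_mul_right ?_ hypos
  have := mul_le_mul_of_nonneg_right hle hspos
  linarith

theorem finite_setOf_lambdaA (α : ℝ) (P : GraphFamily) (n : ℕ) :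
    {y | ∃ G ∈ P n, y = lambdaA α G}.Finite :=
  ((Set.toFinite (P n)).image (lambdaA α)).subset fun _ ⟨G, hG, h⟩ => ⟨G, hG, h.symm⟩

theorem lambdaA_le_lambdaP {α : ℝ} {P : GraphFamily} {n : ℕ} {G : SimpleGraph (Fin n)}
    (hG : G ∈ P n) : lambdaA α G ≤ lambdaP α P n :=
  le_csSup (finite_setOf_lambdaA α P n).bddAbove ⟨G, hG, rfl⟩

theorem exists_lambdaA_eq_lambdaP (α : ℝ) {P : GraphFamily} {n : ℕ} (h : (P n).Nonempty) :
    ∃ G ∈ P n, lambdaP α P n = lambdaA α G := by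
  obtain ⟨G, hG⟩ := h
  have hs : {y | ∃ G ∈ P n, y = lambdaA α G}.Nonempty := ⟨_, G, hG, rfl⟩
  exact hs.csSup_mem (finite_setOf_lambdaA α P n)

theorem lambdaP_succ_mul_le {m : ℕ} (hm : 1 ≤ m) {α : ℝ} (hα : 1 ≤ α) {P : GraphFamily}
    (hP : IsHereditary P) (hne : (P (m + 1)).Nonempty) :
    lambdaP α P (m + 1) * (1 - 2 * (1 / ((m : ℝ) + 1))) ≤
      lambdaP α P m * (1 - 1 / ((m : ℝ) + 1)) ^ (2 / α) := by
  obtain ⟨G, hG, he⟩ := exists_lambdaA_eq_lambdaP α hne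
  obtain ⟨k, hk⟩ := exists_comap_lambdaA_mul_le hm hα G
  rw [he]
  refine hk.trans (mul_le_mul_of_nonneg_right (lambdaA_le_lambdaP (hP _ hG))
    (Real.rpow_nonneg (sub_nonneg.2 ?_) _))
  rw [div_le_one (by positivity)]
  linarith [m.cast_nonneg (α := ℝ)]

/-- For `α ≥ 1` and a hereditary property `P` of graphs containing at least
one graph of every order `n ≥ 1`, the limit `λ^(α)(P) = lim_{n→∞} λ^(α)(P,n) ⬝ n^{2/α - 2}`
exists. -/
theorem lambdaP_tendsto (α : ℝ) (hα : 1 ≤ α) (P : GraphFamily) (hP : IsHereditary P)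
    (hne : ∀ n : ℕ, 1 ≤ n → (P n).Nonempty) :
    ∃ L : ℝ, Tendsto (fun n : ℕ => lambdaP α P n * (n : ℝ) ^ (2 / α - 2)) atTop (nhds L) := by
  set p := 2 / α with hp
  set c : ℕ → ℝ := fun m =>
    lambdaP α P (m + 2) * ((m : ℝ) + 2) ^ p / (((m : ℝ) + 2) * ((m : ℝ) + 1)) with hc
  have hc0 : ∀ m, 0 ≤ c m := by
    intro m
    obtain ⟨G, -, he⟩ := exists_lambdaA_eq_lambdaP α (hne (m + 2) (by omega))
    have : 0 ≤ lambdaP α P (m + 2) := he ▸ lambdaA_nonneg (by linarith) (by omega) G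
    positivity
  have hanti : Antitone c := by
    refine antitone_nat_of_succ_le fun m => ?_
    have h := lambdaP_succ_mul_le (m := m + 2) (by omega) hα hP (hne _ (by omega))
    simp only [hc]
    rw [← hp] at h
    push_cast at h ⊢
    have e₁ : 1 - 2 * (1 / ((m : ℝ) + 2 + 1)) = (m + 1) / (m + 3) := by
      field_simp
      ring
    have e₂ : 1 - 1 / ((m : ℝ) + 2 + 1) = (m + 2) / (m + 3) := by
      field_simp
      ring
    rw [e₁, e₂, Real.div_rpow (by positivity) (by positivity), ← mul_div_assoc,
      ← mul_div_assoc, div_le_div_iff₀ (by positivity) (by positivity)] at h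
    rw [show (m : ℝ) + 1 + 2 = m + 3 by ring, show (m : ℝ) + 1 + 1 = m + 2 by ring,
      div_le_div_iff₀ (by positivity) (by positivity),
      show m + 1 + 2 = m + 2 + 1 by ring]
    have := mul_le_mul_of_nonneg_right h (show 0 ≤ (m : ℝ) + 2 by positivity)
    linarith
  refine ⟨⨅ m, c m, ?_⟩
  have hlim : Tendsto c atTop (nhds (⨅ m, c m)) :=
    tendsto_atTop_ciInf hanti ⟨0, by rintro _ ⟨m, rfl⟩; exact hc0 m⟩
  have hratio : Tendsto (fun m : ℕ => 1 - 1 / ((m : ℝ) + 2)) atTop (nhds (1 - 0)) := by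
    refine tendsto_const_nhds.sub ?_
    simpa using (tendsto_add_atTop_iff_nat 2).2 (tendsto_one_div_atTop_nhds_zero_nat (𝕜 := ℝ))
  rw [← tendsto_add_atTop_iff_nat 2]
  have hmul := hlim.mul hratio
  rw [sub_zero, mul_one] at hmul
  refine hmul.congr fun m => ?_
  have hpos : (0 : ℝ) < m + 2 := by positivity
  simp only [hc]
  push_cast
  rw [Real.rpow_sub hpos, Real.rpow_two]
  field_simp
  ring
end

section
/- Let r ≥ 2, s ≥ 1, β ≥ 2 be integers and let t = R(r,s) be the Ramsey number guaranteeing that every graph on t vertices contains a clique K_r or an independent set of size s. If a finite simple graph G contains no K_r and contains (as a subgraph) a complete β-partite graph K_β(t) with t vertices in each part, then G contains an induced copy of the complete β-partite graph K_β(s) with s vertices in each part. -/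
open Filter

/-- Let `r ≥ 2`, `s ≥ 1`, `β ≥ 2` and let `t` be a Ramsey number for
`(r, s)`: every graph on `t` vertices contains a clique of size `r` or an independent set
of size `s`. If a graph `G` is `K_r`-free and contains the complete `β`-partite graph
`K_β(t)` (with `t` vertices in each part) as a subgraph, then `G` contains an induced copy
of `K_β(s)`. -/
theorem induced_completeMultipartite_of_subgraph (r s β t n : ℕ)
    (hr : 2 ≤ r) (hs : 1 ≤ s) (hβ : 2 ≤ β)
    (ht : ∀ H : SimpleGraph (Fin t),
      (∃ S : Finset (Fin t), H.IsNClique r S) ∨ (∃ S : Finset (Fin t), Hᶜ.IsNClique s S))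
    (G : SimpleGraph (Fin n)) (hKr : G.CliqueFree r)
    (hsub : IsSubgraphOf (SimpleGraph.completeMultipartiteGraph fun _ : Fin β => Fin t) G) :
    IsInducedSubgraph (SimpleGraph.completeMultipartiteGraph fun _ : Fin β => Fin s) G := by
  obtain ⟨f, hf⟩ := hsub
  let g (i : Fin β) : Fin t ↪ Fin n := (Function.Embedding.sigmaMk i).trans f
  have hindep (i : Fin β) : ∃ S : Finset (Fin t), (G.comap (g i))ᶜ.IsNClique s S :=
    (ht (G.comap (g i))).resolve_left fun ⟨S, hS⟩ =>
      hKr.comap (SimpleGraph.Embedding.comap (g i) G).isContained S hS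
  choose S hS using hindep
  let e (i : Fin β) : Fin s ↪ Fin t := ((S i).orderEmbOfFin (hS i).card_eq).toEmbedding
  refine ⟨(Function.Embedding.sigmaMap (.refl _) e).trans f, ?_⟩
  rintro ⟨i, a⟩ ⟨j, b⟩
  refine ⟨fun h hij => ?_, fun h => hf _ _ h⟩
  obtain rfl : i = j := hij
  have h : G.Adj (g i (e i a)) (g i (e i b)) := h
  have hab : e i a ≠ e i b := fun hab => h.ne (congrArg (g i) hab)
  exact ((hS i).isClique (Finset.orderEmbOfFin_mem _ _ a)
    (Finset.orderEmbOfFin_mem _ _ b) hab).2 h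
end

section
/- Let F be a family of finite simple graphs with ω̲(F) ≥ 2 and β(F) ≥ 2, let F₀ ∈ F be a complete β(F)-partite graph, and suppose every complete β(F)-partite graph with s vertices in each class (where s is the maximum class size of F₀) contains an induced copy of F₀. Then for every ε > 0 there exists N such that for all n ≥ N, every graph G of order n with no member of F as an induced subgraph satisfies e(G) ≤ (1 − 1/(β(F)−1) + ε)·C(n,2). -/
open Filter

open Finset in
/-- **Ramsey's theorem** for two colours: a large enough set of vertices contains a clique of
size `a` or an independent set of size `b`. -/
theorem SimpleGraph.exists_forall_isNClique_or_isNIndepSet (a b : ℕ) :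
    ∃ R : ℕ, ∀ {V : Type*} (G : SimpleGraph V) (s : Finset V), R ≤ #s →
      (∃ t ⊆ s, G.IsNClique a t) ∨ ∃ t ⊆ s, G.IsNIndepSet b t := by
  classical
  induction a generalizing b with
  | zero => exact ⟨0, fun G s _ => .inl ⟨∅, by simp, by simp⟩⟩
  | succ a iha =>
    induction b with
    | zero => exact ⟨0, fun G s _ => .inr ⟨∅, by simp, by simp [isNIndepSet_iff]⟩⟩
    | succ b ihb =>
      obtain ⟨R₁, h₁⟩ := iha (b + 1)
      obtain ⟨R₂, h₂⟩ := ihb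
      refine ⟨R₁ + R₂ + 1, fun G s hs => ?_⟩
      obtain ⟨v, hv⟩ : s.Nonempty := card_pos.mp (by omega)
      have hsub (p : _ → Prop) [DecidablePred p] : {w ∈ s.erase v | p w} ⊆ s :=
        (filter_subset _ _).trans (erase_subset v s)
      have hcard : #{w ∈ s.erase v | G.Adj v w} + #{w ∈ s.erase v | ¬ G.Adj v w} = #s - 1 := by
        rw [card_filter_add_card_filter_not, card_erase_of_mem hv]
      rcases le_or_gt R₁ #{w ∈ s.erase v | G.Adj v w} with h | h
      · rcases h₁ G _ h with ⟨t, hts, ht⟩ | ⟨t, hts, ht⟩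
        · refine .inl ⟨insert v t, insert_subset hv (hts.trans (hsub _)), ht.insert fun w hw => ?_⟩
          exact (mem_filter.mp (hts hw)).2
        · exact .inr ⟨t, hts.trans (hsub _), ht⟩
      · rcases h₂ G {w ∈ s.erase v | ¬ G.Adj v w} (by omega) with ⟨t, hts, ht⟩ | ⟨t, hts, ht⟩
        · exact .inl ⟨t, hts.trans (hsub _), ht⟩
        · refine .inr ⟨insert v t, insert_subset hv (hts.trans (hsub _)), ?_⟩
          rw [← isNClique_compl] at ht ⊢
          refine ht.insert fun w hw => ?_
          have hw := mem_filter.mp (hts hw)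
          exact (compl_adj _ _ _).mpr ⟨(ne_of_mem_erase hw.1).symm, hw.2⟩

/-- If large `H`-free graphs of order `n` have minimum degree at most `c * n`, then the extremal
number of `H` is at most `c * n * (n + 1) / 2` up to an additive constant. -/
theorem SimpleGraph.extremalNumber_le_of_minDegree_le {W : Type*} {H : SimpleGraph W}
    {c : ℝ} (hc : 0 ≤ c) {N : ℕ}
    (h : ∀ n, N ≤ n → ∀ (G : SimpleGraph (Fin n)) [DecidableRel G.Adj], H.Free G →
      (G.minDegree : ℝ) ≤ c * n) (n : ℕ) (hn : N ≤ n) :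
    (extremalNumber n H : ℝ) ≤ extremalNumber N H + c * (n * (n + 1) / 2) := by
  induction n, hn using Nat.le_induction with
  | base => exact le_add_of_nonneg_right (by positivity)
  | succ n hn ih =>
    have hstep : (extremalNumber (n + 1) H : ℝ) ≤ extremalNumber n H + c * (n + 1) := by
      conv_lhs => rw [← Fintype.card_fin (n + 1)]
      rw [extremalNumber_le_iff_of_nonneg H (by positivity)]
      intro G _ hG
      obtain ⟨v, hv⟩ := G.exists_minimal_degree_vertex
      have hdel := card_edgeFinset_deleteIncidenceSet_le_extremalNumber hG v
      rw [card_edgeFinset_deleteIncidenceSet, Fintype.card_fin, Nat.add_sub_cancel, ← hv,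
        tsub_le_iff_right] at hdel
      have hmin := h (n + 1) (by omega) G hG
      have hdel' : (G.edgeFinset.card : ℝ) ≤ extremalNumber n H + G.minDegree := mod_cast hdel
      push_cast at hmin
      linarith
    push_cast
    linarith

/-- The **Erdős–Stone theorem** for extremal numbers. -/
theorem SimpleGraph.eventually_extremalNumber_completeEquipartiteGraph_le
    {ε : ℝ} (hε : 0 < ε) {r : ℕ} (hr : 1 ≤ r) (t : ℕ) :
    ∀ᶠ n : ℕ in atTop, (extremalNumber n (completeEquipartiteGraph (r + 1) t) : ℝ) ≤
      (1 - 1 / r + ε) * n.choose 2 := by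
  obtain ⟨N, hN⟩ := eventually_atTop.mp
    (eventually_completeEquipartiteGraph_isContained_of_minDegree (half_pos hε) r t)
  have hr' : (1 : ℝ) / r ≤ 1 := by
    rw [div_le_one (by positivity)]
    exact_mod_cast hr
  set c : ℝ := 1 - 1 / r + ε / 2 with hc_def
  have hc : 0 ≤ c := by linarith
  set C := (extremalNumber N (completeEquipartiteGraph (r + 1) t) : ℝ)
  have hC : 0 ≤ C := by positivity
  filter_upwards [eventually_ge_atTop N, eventually_ge_atTop 1,
    eventually_ge_atTop (⌈4 * (C + c) / ε⌉₊ + 1)] with n hNn hn1 hn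
  have hle := extremalNumber_le_of_minDegree_le
    (H := completeEquipartiteGraph (r + 1) t) hc (N := N)
    (fun m hm G _ hG => le_of_not_ge fun hd => hG (hN m hm hd)) n hNn
  have hn1' : (1 : ℝ) ≤ n := mod_cast hn1
  have hn' : 4 * (C + c) ≤ (n - 1) * ε := by
    have h₁ : ((⌈4 * (C + c) / ε⌉₊ : ℝ) + 1) ≤ n := mod_cast hn
    have h₂ := Nat.le_ceil (4 * (C + c) / ε)
    rw [← div_le_iff₀ hε]
    linarith
  have hn'' := mul_le_mul_of_nonneg_right hn' (by linarith : (0 : ℝ) ≤ n)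
  have hCn : C ≤ C * n := le_mul_of_one_le_right hC hn1'
  rw [Nat.cast_choose_two, show 1 - 1 / (r : ℝ) + ε = c + ε / 2 by rw [hc_def]; ring]
  linarith

/-- If `R` vertices of `G` always span an independent set of size `s`, then a copy in `G` of the
complete `r`-partite graph with parts of size `R` contains an induced copy of the complete
`r`-partite graph with parts of size `s`. -/
theorem isInducedSubgraph_completeMultipartiteGraph_of_isContained {V : Type*}
    {G : SimpleGraph V} {r s R : ℕ}
    (hR : ∀ A : Finset V, R ≤ A.card → ∃ t ⊆ A, G.IsNIndepSet s t)
    (h : (SimpleGraph.completeEquipartiteGraph r R).IsContained G) :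
    IsInducedSubgraph (SimpleGraph.completeMultipartiteGraph fun _ : Fin r => Fin s) G := by
  obtain ⟨f⟩ := h
  have hinj (i : Fin r) : Function.Injective fun j : Fin R => f (i, j) := fun j k hjk =>
    (Prod.ext_iff.mp (f.injective hjk)).2
  choose t ht hind using fun i : Fin r =>
    hR (Finset.univ.map ⟨_, hinj i⟩) (by simp)
  have hmem {i : Fin r} {v : V} (hv : v ∈ t i) : ∃ j, f (i, j) = v := by
    simpa using ht i hv
  have hadj {i j : Fin r} (hij : i ≠ j) {v w : V} (hv : v ∈ t i) (hw : w ∈ t j) : G.Adj v w := by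
    obtain ⟨k, rfl⟩ := hmem hv
    obtain ⟨l, rfl⟩ := hmem hw
    exact f.toHom.map_adj (SimpleGraph.completeEquipartiteGraph_adj.mpr hij)
  let g (x : Σ _ : Fin r, Fin s) : V := ((t x.1).equivFinOfCardEq (hind x.1).card_eq).symm x.2
  have hg (x) : g x ∈ t x.1 := Subtype.coe_prop _
  refine ⟨⟨g, ?_⟩, fun x y => ?_⟩
  · rintro ⟨i, k⟩ ⟨j, l⟩ hxy
    obtain rfl | hij := eq_or_ne i j
    · simpa [g, Subtype.val_inj] using hxy
    · exact absurd hxy (hadj hij (hg ⟨i, k⟩) (hg ⟨j, l⟩)).ne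
  · change G.Adj (g x) (g y) ↔ x.1 ≠ y.1
    refine ⟨fun h hxy => ?_, fun hxy => hadj hxy (hg x) (hg y)⟩
    exact (hind x.1).isIndepSet (hg x) (hxy ▸ hg y) h.ne h

theorem IsInducedSubgraph.trans {U V W : Type*} {G : SimpleGraph U} {H : SimpleGraph V}
    {K : SimpleGraph W} : IsInducedSubgraph G H → IsInducedSubgraph H K → IsInducedSubgraph G K
  | ⟨f, hf⟩, ⟨g, hg⟩ => ⟨f.trans g, fun u v => (hg _ _).trans (hf u v)⟩

theorem SimpleGraph.IsNClique.isInducedSubgraph_top {V : Type*} {G : SimpleGraph V} {a : ℕ}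
    {t : Finset V} (ht : G.IsNClique a t) : IsInducedSubgraph (⊤ : SimpleGraph (Fin a)) G :=
  let f := topEmbeddingOfNotCliqueFree ht.not_cliqueFree
  ⟨f.toEmbedding, fun _ _ => f.map_adj_iff⟩

/-- Let `F` satisfy `ω̲(F) ≥ 2` and `β(F) ≥ 2`, let `F₀ ∈ F` be a complete
`β(F)`-partite graph, and suppose the complete `β(F)`-partite graph with `s` vertices in each
class (`s` being the maximum class size of `F₀`) contains an induced copy of `F₀`.  Then for
every `ε > 0` there is `N` such that for all `n ≥ N`, every graph `G` of order `n` with no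
member of `F` as an induced subgraph has `e(G) ≤ (1 - 1/(β(F)-1) + ε)·C(n,2)`. -/
theorem edge_upper_bound_of_her (F : GraphFamily) (hω : 2 ≤ omegaLow F) (hβ : 2 ≤ betaF F)
    (n₀ : ℕ) (F₀ : SimpleGraph (Fin n₀)) (hF₀ : F₀ ∈ F n₀)
    (hF₀p : IsCompletePartite (betaF F) F₀) (s : ℕ)
    (hs : IsInducedSubgraph F₀
      (SimpleGraph.completeMultipartiteGraph fun _ : Fin (betaF F) => Fin s)) :
    ∀ ε : ℝ, 0 < ε → ∃ N : ℕ, ∀ n : ℕ, N ≤ n → ∀ G : SimpleGraph (Fin n), G ∈ Her F n →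
      (edgeCount G : ℝ) ≤ (1 - 1 / ((betaF F : ℝ) - 1) + ε) * (n.choose 2 : ℝ) := by
  intro ε hε
  obtain ⟨ha, haF⟩ := Nat.sInf_mem (Nat.nonempty_of_pos_sInf (zero_lt_two.trans_le hω))
  change 1 ≤ omegaLow F at ha
  change ⊤ ∈ F (omegaLow F) at haF
  have hn₀ : 1 ≤ n₀ := by
    obtain ⟨c, hc, -⟩ := hF₀p
    obtain ⟨v, -⟩ := hc ⟨0, by omega⟩
    exact v.pos
  obtain ⟨R, hR⟩ := SimpleGraph.exists_forall_isNClique_or_isNIndepSet (omegaLow F) s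
  obtain ⟨r, hr⟩ : ∃ r, betaF F = r + 1 := ⟨betaF F - 1, by omega⟩
  rw [hr] at hs
  obtain ⟨N, hN⟩ := eventually_atTop.mp
    (SimpleGraph.eventually_extremalNumber_completeEquipartiteGraph_le hε
      (show 1 ≤ r by omega) R)
  refine ⟨N, fun n hn G hG => ?_⟩
  classical
  have hfree : (SimpleGraph.completeEquipartiteGraph (r + 1) R).Free G := fun hcon =>
    hG n₀ hn₀ F₀ hF₀ <| hs.trans <|
      isInducedSubgraph_completeMultipartiteGraph_of_isContained (fun A hA =>
        (hR G A hA).resolve_left fun ⟨_, _, ht⟩ => hG _ ha ⊤ haF ht.isInducedSubgraph_top) hcon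
  have hle := SimpleGraph.card_edgeFinset_le_extremalNumber hfree
  rw [Fintype.card_fin, ← Set.ncard_coe_finset, SimpleGraph.coe_edgeFinset] at hle
  rw [hr, Nat.cast_add_one, add_sub_cancel_right]
  exact (Nat.cast_le.mpr hle).trans (hN n hn)
end

section
/- Let α ≥ 1 be a real number and r ≥ 1 an integer. If G is a finite simple graph with m edges and n vertices containing no clique K_{r+1}, then λ^(α)(G) ≤ (1 − 1/r)^{1/α} · (2m)^{1 − 1/α}. -/
open Filter

open Finset Matrix in
/-- The **Motzkin–Straus inequality**: the quadratic form of the adjacency matrix of a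
`K_{r+1}`-free graph is at most `(1 - 1/r) * (∑ v, w v) ^ 2` on nonnegative vectors. -/
theorem motzkinStraus {V : Type*} [Fintype V] [DecidableEq V] (G : SimpleGraph V)
    [DecidableRel G.Adj] {r : ℕ} (hr : 1 ≤ r) (hG : G.CliqueFree (r + 1)) (w : V → ℝ)
    (hw : ∀ v, 0 ≤ w v) :
    w ⬝ᵥ (G.adjMatrix ℝ *ᵥ w) ≤ (1 - 1 / (r : ℝ)) * (∑ v, w v) ^ 2 := by
  induction hk : #{v | w v ≠ 0} using Nat.strong_induction_on generalizing w with
  | _ k ih =>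
  by_cases hclique : G.IsClique ({v | w v ≠ 0} : Finset V)
  · have hcard : #{v | w v ≠ 0} ≤ r := by
      by_contra! hlt
      exact (hG.mono hlt) _ ⟨hclique, rfl⟩
    have hsum : ∑ v with w v ≠ 0, w v = ∑ v, w v := sum_filter_ne_zero _
    have hsq : (∑ v, w v) ^ 2 ≤ r * ∑ v, w v ^ 2 := by
      calc (∑ v, w v) ^ 2 = (∑ v with w v ≠ 0, w v) ^ 2 := by rw [hsum]
        _ ≤ #{v | w v ≠ 0} * ∑ v with w v ≠ 0, w v ^ 2 := sq_sum_le_card_mul_sum_sq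
        _ ≤ r * ∑ v, w v ^ 2 := by
          gcongr
          exact subset_univ _
    have hform : w ⬝ᵥ (G.adjMatrix ℝ *ᵥ w) ≤ (∑ v, w v) ^ 2 - ∑ v, w v ^ 2 := by
      have hrow : ∀ u, w u * (G.adjMatrix ℝ *ᵥ w) u ≤ w u * ∑ v, w v - w u ^ 2 := by
        intro u
        rw [sq, ← mul_sub]
        refine mul_le_mul_of_nonneg_left ?_ (hw u)
        rw [SimpleGraph.adjMatrix_mulVec_apply, ← sum_erase_eq_sub (mem_univ u)]
        refine sum_le_sum_of_subset_of_nonneg (fun v hv => ?_) fun v _ _ => hw v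
        simpa using (G.ne_of_adj ((G.mem_neighborFinset u v).1 hv)).symm
      calc w ⬝ᵥ (G.adjMatrix ℝ *ᵥ w) ≤ ∑ u, (w u * ∑ v, w v - w u ^ 2) :=
            sum_le_sum fun u _ => hrow u
        _ = (∑ v, w v) ^ 2 - ∑ v, w v ^ 2 := by
            rw [sum_sub_distrib, ← sum_mul, sq]
    have hr0 : (0 : ℝ) < r := by exact_mod_cast hr
    have hdiv : (∑ v, w v) ^ 2 / r ≤ ∑ v, w v ^ 2 := by
      rwa [div_le_iff₀' hr0]
    calc _ ≤ _ := hform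
      _ ≤ (∑ v, w v) ^ 2 - (∑ v, w v) ^ 2 / r := by linarith
      _ = _ := by ring
  · obtain ⟨u, v, hu, hv, huv, hadj, hle⟩ : ∃ u v, w u ≠ 0 ∧ w v ≠ 0 ∧ u ≠ v ∧ ¬G.Adj u v ∧
        (G.adjMatrix ℝ *ᵥ w) v ≤ (G.adjMatrix ℝ *ᵥ w) u := by
      simp only [SimpleGraph.isClique_iff, Set.Pairwise, coe_filter, mem_univ, true_and,
        Set.mem_ofPred_eq] at hclique
      push Not at hclique
      obtain ⟨u, hu, v, hv, huv, hadj⟩ := hclique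
      rcases le_total ((G.adjMatrix ℝ *ᵥ w) v) ((G.adjMatrix ℝ *ᵥ w) u) with h | h
      · exact ⟨u, v, hu, hv, huv, hadj, h⟩
      · exact ⟨v, u, hv, hu, huv.symm, fun h' => hadj h'.symm, h⟩
    set d : V → ℝ := Pi.single u 1 - Pi.single v 1 with hd
    set w' : V → ℝ := w + w v • d with hw'
    have hw'v : w' v = 0 := by simp [hw', hd, huv.symm]
    have hw'u : w' u = w u + w v := by simp [hw', hd, huv]
    have hw'ne : ∀ z, z ≠ u → z ≠ v → w' z = w z := by
      intro z hzu hzv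
      simp [hw', hd, hzu, hzv]
    have hnonneg : ∀ z, 0 ≤ w' z := by
      intro z
      rcases eq_or_ne z v with rfl | hzv
      · exact hw'v.ge
      rcases eq_or_ne z u with rfl | hzu
      · exact hw'u ▸ add_nonneg (hw _) (hw _)
      · exact hw'ne z hzu hzv ▸ hw z
    have hsupp : #{z | w' z ≠ 0} < k := by
      rw [← hk]
      refine card_lt_card (ssubset_iff_of_subset ?_ |>.2 ⟨v, by simpa using hv, by simpa using hw'v⟩)
      intro z hz
      simp only [mem_filter, mem_univ, true_and] at hz ⊢
      rcases eq_or_ne z u with rfl | hzu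
      · exact hu
      · have hzv : z ≠ v := by
          rintro rfl
          exact hz hw'v
        rwa [hw'ne z hzu hzv] at hz
    have hsum : ∑ z, w' z = ∑ z, w z := by
      simp [hw', hd, sum_add_distrib, ← mul_sum]
    have hsymm : w ⬝ᵥ (G.adjMatrix ℝ *ᵥ d) = d ⬝ᵥ (G.adjMatrix ℝ *ᵥ w) := by
      rw [dotProduct_mulVec, ← mulVec_transpose, SimpleGraph.transpose_adjMatrix, dotProduct_comm]
    have hdw : d ⬝ᵥ (G.adjMatrix ℝ *ᵥ w) = (G.adjMatrix ℝ *ᵥ w) u - (G.adjMatrix ℝ *ᵥ w) v := by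
      simp [hd, sub_dotProduct]
    have hdd : d ⬝ᵥ (G.adjMatrix ℝ *ᵥ d) = 0 := by
      have hadj' : ¬G.Adj v u := fun h => hadj h.symm
      simp [hd, sub_dotProduct, mulVec_sub, hadj, hadj']
    have hform : w' ⬝ᵥ (G.adjMatrix ℝ *ᵥ w') = w ⬝ᵥ (G.adjMatrix ℝ *ᵥ w) +
        2 * w v * ((G.adjMatrix ℝ *ᵥ w) u - (G.adjMatrix ℝ *ᵥ w) v) := by
      simp only [hw', mulVec_add, mulVec_smul, add_dotProduct, dotProduct_add, smul_dotProduct,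
        dotProduct_smul, hsymm, hdd, hdw, smul_eq_mul]
      ring
    have hstep := ih _ hsupp w' hnonneg rfl
    rw [hsum, hform] at hstep
    have := mul_nonneg (mul_nonneg zero_le_two (hw v)) (sub_nonneg.2 hle)
    linarith

open Finset Matrix in
/-- The bound on `quadSum G x` for a single normalized vector `x`. -/
theorem quadSum_le_of_cliqueFree {α : ℝ} (hα : 1 ≤ α) {r n : ℕ} (hr : 1 ≤ r)
    {G : SimpleGraph (Fin n)} (hG : G.CliqueFree (r + 1)) {x : Fin n → ℝ}
    (hx : ∑ i, |x i| ^ α = 1) :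
    quadSum G x ≤
      (1 - 1 / (r : ℝ)) ^ (1 / α) * (2 * (edgeCount G : ℝ)) ^ (1 - 1 / α) := by
  classical
  have hα0 : 0 < α := zero_lt_one.trans_le hα
  set D : Finset (Fin n × Fin n) := {p | G.Adj p.1 p.2} with hD
  have hcard : (#D : ℝ) = 2 * (edgeCount G : ℝ) := by
    have hdeg : #D = ∑ v, G.degree v := by
      rw [hD, card_filter, Fintype.sum_prod_type]
      refine sum_congr rfl fun v _ => ?_
      rw [← card_filter, ← G.neighborFinset_eq_filter, G.card_neighborFinset_eq_degree]
    have hedge : edgeCount G = #G.edgeFinset := by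
      rw [edgeCount, ← G.coe_edgeFinset, Set.ncard_coe_finset]
    rw [hdeg, G.sum_degrees_eq_twice_card_edges, hedge]
    push_cast
    ring
  have habs : quadSum G x ≤ ∑ p ∈ D, |x p.1 * x p.2| := by
    rw [hD, sum_filter, Fintype.sum_prod_type, quadSum]
    refine sum_le_sum fun u _ => sum_le_sum fun v _ => ?_
    split_ifs
    · exact le_abs_self _
    · exact le_rfl
  have hstraus : ∑ p ∈ D, |x p.1 * x p.2| ^ α ≤ 1 - 1 / (r : ℝ) := by
    have := motzkinStraus G hr hG (fun i => |x i| ^ α) fun i => by positivity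
    rw [hx, one_pow, mul_one] at this
    refine le_of_eq_of_le ?_ this
    rw [hD, sum_filter, Fintype.sum_prod_type, dotProduct]
    refine sum_congr rfl fun u _ => ?_
    rw [SimpleGraph.adjMatrix_mulVec_apply, G.neighborFinset_eq_filter, sum_filter, mul_sum]
    refine sum_congr rfl fun v _ => ?_
    split_ifs
    · rw [abs_mul, Real.mul_rpow (abs_nonneg _) (abs_nonneg _)]
    · rw [mul_zero]
  have hr0 : (0 : ℝ) ≤ 1 - 1 / (r : ℝ) :=
    (sum_nonneg fun p _ => by positivity).trans hstraus
  have hpow : (∑ p ∈ D, |x p.1 * x p.2|) ^ α ≤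
      (2 * (edgeCount G : ℝ)) ^ (α - 1) * (1 - 1 / (r : ℝ)) := by
    rw [← hcard]
    exact (Real.rpow_sum_le_const_mul_sum_rpow D (fun p => x p.1 * x p.2) hα).trans
      (mul_le_mul_of_nonneg_left hstraus (by positivity))
  calc quadSum G x ≤ ∑ p ∈ D, |x p.1 * x p.2| := habs
    _ = ((∑ p ∈ D, |x p.1 * x p.2|) ^ α) ^ (1 / α) := by
        rw [one_div, Real.rpow_rpow_inv (by positivity) hα0.ne']
    _ ≤ ((2 * (edgeCount G : ℝ)) ^ (α - 1) * (1 - 1 / (r : ℝ))) ^ (1 / α) := by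
        gcongr
    _ = (1 - 1 / (r : ℝ)) ^ (1 / α) * (2 * (edgeCount G : ℝ)) ^ (1 - 1 / α) := by
        rw [Real.mul_rpow (by positivity) hr0, ← Real.rpow_mul (by positivity), mul_comm]
        congr 2
        field_simp

/-- For `α ≥ 1` and `r ≥ 1`, if `G` is a `K_{r+1}`-free graph with `m`
edges, then `λ^(α)(G) ≤ (1 - 1/r)^{1/α} (2m)^{1 - 1/α}`. -/
theorem lambdaA_le_of_cliqueFree_edges (α : ℝ) (hα : 1 ≤ α) (r n : ℕ) (hr : 1 ≤ r)
    (G : SimpleGraph (Fin n)) (hG : G.CliqueFree (r + 1)) :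
    lambdaA α G ≤ (1 - 1 / (r : ℝ)) ^ (1 / α) * (2 * (edgeCount G : ℝ)) ^ (1 - 1 / α) := by
  refine Real.sSup_le ?_ ?_
  · rintro y ⟨x, hx, rfl⟩
    exact quadSum_le_of_cliqueFree hα hr hG hx
  · have hr1 : 1 / (r : ℝ) ≤ 1 := by
      rw [one_div]
      exact inv_le_one_of_one_le₀ (by exact_mod_cast hr)
    have : 0 ≤ 1 - 1 / (r : ℝ) := sub_nonneg.2 hr1
    positivity
end

section
/- Let α ≥ 1 be a real number and r ≥ 1 an integer. If G is a finite simple graph with n vertices containing no clique K_{r+1}, then λ^(α)(G) ≤ (1 − 1/r) · n^{2 − 2/α}. -/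
open Filter

open scoped Matrix

/-- Moving the weight of `v` onto a non-adjacent vertex `u` whose weighted degree is at least
that of `v` does not decrease the quadratic form of the adjacency matrix. -/
theorem dotProduct_adjMatrix_mulVec_le_shift {V : Type*} [Fintype V] [DecidableEq V]
    (G : SimpleGraph V) [DecidableRel G.Adj] {x : V → ℝ} {u v : V} (huv : ¬ G.Adj u v)
    (hv : 0 ≤ x v) (hle : (G.adjMatrix ℝ *ᵥ x) v ≤ (G.adjMatrix ℝ *ᵥ x) u) :
    x ⬝ᵥ (G.adjMatrix ℝ *ᵥ x) ≤
      (x + x v • (Pi.single u 1 - Pi.single v 1)) ⬝ᵥ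
        (G.adjMatrix ℝ *ᵥ (x + x v • (Pi.single u 1 - Pi.single v 1))) := by
  set d : V → ℝ := Pi.single u 1 - Pi.single v 1 with hd
  have hvu : ¬ G.Adj v u := fun h => huv h.symm
  have hdx : d ⬝ᵥ (G.adjMatrix ℝ *ᵥ x) =
      (G.adjMatrix ℝ *ᵥ x) u - (G.adjMatrix ℝ *ᵥ x) v := by
    simp [hd, sub_dotProduct]
  have hxd : x ⬝ᵥ (G.adjMatrix ℝ *ᵥ d) = d ⬝ᵥ (G.adjMatrix ℝ *ᵥ x) := by
    rw [Matrix.dotProduct_mulVec, ← Matrix.mulVec_transpose, SimpleGraph.transpose_adjMatrix,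
      dotProduct_comm]
  have hdd : d ⬝ᵥ (G.adjMatrix ℝ *ᵥ d) = 0 := by
    simp [hd, sub_dotProduct, Matrix.mulVec_sub, SimpleGraph.adjMatrix_apply, huv, hvu]
  rw [Matrix.mulVec_add, Matrix.mulVec_smul, add_dotProduct, dotProduct_add, dotProduct_add,
    smul_dotProduct, smul_dotProduct, dotProduct_smul, dotProduct_smul, hxd, hdd, hdx]
  simp only [smul_eq_mul]
  nlinarith [mul_nonneg hv (sub_nonneg.2 hle)]

/-- The Motzkin–Straus bound for a weighting supported on at most `r` vertices. -/
theorem dotProduct_adjMatrix_mulVec_le_of_card_support_le {V : Type*} [Fintype V] [DecidableEq V]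
    (G : SimpleGraph V) [DecidableRel G.Adj] {r : ℕ} (hr : 1 ≤ r) {x : V → ℝ} (hx : ∀ i, 0 ≤ x i)
    (hcard : (Finset.univ.filter fun i => x i ≠ 0).card ≤ r) :
    x ⬝ᵥ (G.adjMatrix ℝ *ᵥ x) ≤ (1 - 1 / (r : ℝ)) * (∑ i, x i) ^ 2 := by
  have hr0 : (0 : ℝ) < r := by exact_mod_cast hr
  have hquad : x ⬝ᵥ (G.adjMatrix ℝ *ᵥ x) ≤ (∑ i, x i) ^ 2 - ∑ i, x i ^ 2 := by
    rw [sq, Finset.sum_mul_sum, ← Finset.sum_sub_distrib]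
    simp only [dotProduct, Matrix.mulVec, SimpleGraph.adjMatrix_apply]
    refine Finset.sum_le_sum fun i _ => ?_
    have hi : x i ^ 2 = ∑ j, if i = j then x i * x j else 0 := by simp [sq]
    rw [hi, ← Finset.sum_sub_distrib, Finset.mul_sum]
    refine Finset.sum_le_sum fun j _ => ?_
    have := mul_nonneg (hx i) (hx j)
    by_cases hij : i = j
    · subst hij; simp
    · by_cases hadj : G.Adj i j <;> simp [hij, hadj, this]
  have hcs : (∑ i, x i) ^ 2 ≤ r * ∑ i, x i ^ 2 := by
    have h := sq_sum_le_card_mul_sum_sq (s := Finset.univ.filter fun i => x i ≠ 0) (f := x)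
    rw [Finset.sum_filter_ne_zero] at h
    refine h.trans (mul_le_mul (by exact_mod_cast hcard) ?_ (by positivity) hr0.le)
    exact Finset.sum_le_sum_of_subset_of_nonneg (Finset.filter_subset _ _) fun _ _ _ => sq_nonneg _
  have hdiv : (∑ i, x i) ^ 2 / r ≤ ∑ i, x i ^ 2 := by
    rwa [div_le_iff₀' hr0]
  calc _ ≤ (∑ i, x i) ^ 2 - (∑ i, x i) ^ 2 / r := by linarith
    _ = _ := by ring

/-- The Motzkin–Straus inequality. -/
theorem motzkin_straus {V : Type*} [Fintype V] [DecidableEq V]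
    (G : SimpleGraph V) [DecidableRel G.Adj] {r : ℕ} (hr : 1 ≤ r) (hG : G.CliqueFree (r + 1))
    (x : V → ℝ) (hx : ∀ i, 0 ≤ x i) :
    x ⬝ᵥ (G.adjMatrix ℝ *ᵥ x) ≤ (1 - 1 / (r : ℝ)) * (∑ i, x i) ^ 2 := by
  induction hk : (Finset.univ.filter fun i => x i ≠ 0).card using Nat.strong_induction_on
    generalizing x with
  | _ k ih =>
  by_cases hkr : k ≤ r
  · exact dotProduct_adjMatrix_mulVec_le_of_card_support_le G hr hx (hk ▸ hkr)
  have hnc : ¬ G.IsClique (Finset.univ.filter fun i => x i ≠ 0 : Finset V) := fun hc =>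
    hG.mono (by omega : r + 1 ≤ k) _ ⟨hc, hk⟩
  obtain ⟨u, v, hu, hv, hne, hadj, hle⟩ : ∃ u v, x u ≠ 0 ∧ x v ≠ 0 ∧ u ≠ v ∧ ¬ G.Adj u v ∧
      (G.adjMatrix ℝ *ᵥ x) v ≤ (G.adjMatrix ℝ *ᵥ x) u := by
    simp only [SimpleGraph.isClique_iff, Set.Pairwise, not_forall] at hnc
    obtain ⟨u, hu, v, hv, hne, hadj⟩ := hnc
    have hu : x u ≠ 0 := by simpa using hu
    have hv : x v ≠ 0 := by simpa using hv
    rcases le_total ((G.adjMatrix ℝ *ᵥ x) v) ((G.adjMatrix ℝ *ᵥ x) u) with h | h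
    · exact ⟨u, v, hu, hv, hne, hadj, h⟩
    · exact ⟨v, u, hv, hu, hne.symm, fun h => hadj h.symm, h⟩
  refine (dotProduct_adjMatrix_mulVec_le_shift G hadj (hx v) hle).trans ?_
  set y : V → ℝ := x + x v • (Pi.single u 1 - Pi.single v 1) with hy
  have hyu : y u = x u + x v := by simp [hy, hne]
  have hyv : y v = 0 := by simp [hy, hne.symm]
  have hyo : ∀ i, i ≠ u → i ≠ v → y i = x i := fun i h1 h2 => by simp [hy, h1, h2]
  have hsum : ∑ i, y i = ∑ i, x i := by
    simp [hy, Finset.sum_add_distrib, ← Finset.mul_sum]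
  rw [← hsum]
  refine ih _ ?_ y (fun i => ?_) rfl
  · rw [← hk]
    refine Finset.card_lt_card ((Finset.ssubset_iff_of_subset fun i hi => ?_).2
      ⟨v, by simpa using hv, by simp [hyv]⟩)
    simp only [Finset.mem_filter, Finset.mem_univ, true_and] at hi ⊢
    by_cases h1 : i = u
    · exact h1 ▸ hu
    by_cases h2 : i = v
    · exact h2 ▸ hv
    rwa [← hyo i h1 h2]
  · by_cases h1 : i = u
    · rw [h1, hyu]; exact add_nonneg (hx u) (hx v)
    by_cases h2 : i = v
    · rw [h2, hyv]
    rw [hyo i h1 h2]; exact hx i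

/-- `quadSum` of a weighting is at most the quadratic form of the adjacency matrix at its
absolute value. -/
theorem quadSum_le_dotProduct_abs {n : ℕ} (G : SimpleGraph (Fin n)) [DecidableRel G.Adj]
    (x : Fin n → ℝ) :
    quadSum G x ≤ (fun i => |x i|) ⬝ᵥ (G.adjMatrix ℝ *ᵥ fun i => |x i|) := by
  simp only [quadSum, dotProduct, Matrix.mulVec, SimpleGraph.adjMatrix_apply, Finset.mul_sum]
  refine Finset.sum_le_sum fun i _ => Finset.sum_le_sum fun j _ => ?_
  by_cases hadj : G.Adj i j
  · simpa [hadj, abs_mul] using le_abs_self (x i * x j)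
  · simp [hadj]

/-- The power mean inequality for a vector of `ℓ^α` norm one. -/
theorem sq_sum_abs_le_card_rpow {n : ℕ} {α : ℝ} (hα : 1 ≤ α) {x : Fin n → ℝ}
    (hx : ∑ i, |x i| ^ α = 1) : (∑ i, |x i|) ^ 2 ≤ (n : ℝ) ^ (2 - 2 / α) := by
  have hα0 : 0 < α := by linarith
  have hs : 0 ≤ ∑ i, |x i| := Finset.sum_nonneg fun _ _ => abs_nonneg _
  have h := Real.rpow_sum_le_const_mul_sum_rpow Finset.univ x hα
  rw [hx, mul_one, Finset.card_univ, Fintype.card_fin] at h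
  have h2 := Real.rpow_le_rpow (Real.rpow_nonneg hs α) h (by positivity : 0 ≤ 2 / α)
  rw [← Real.rpow_mul hs, ← Real.rpow_mul (Nat.cast_nonneg n), mul_div_cancel₀ _ hα0.ne',
    Real.rpow_two] at h2
  convert h2 using 2
  field_simp

/-- For `α ≥ 1` and `r ≥ 1`, if `G` is a `K_{r+1}`-free graph of order
`n`, then `λ^(α)(G) ≤ (1 - 1/r) n^{2 - 2/α}`. -/
theorem lambdaA_le_of_cliqueFree_order (α : ℝ) (hα : 1 ≤ α) (r n : ℕ) (hr : 1 ≤ r)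
    (G : SimpleGraph (Fin n)) (hG : G.CliqueFree (r + 1)) :
    lambdaA α G ≤ (1 - 1 / (r : ℝ)) * (n : ℝ) ^ (2 - 2 / α) := by
  classical
  have hr1 : (1 : ℝ) ≤ r := by exact_mod_cast hr
  have hcoef : 0 ≤ 1 - 1 / (r : ℝ) := sub_nonneg.2 (div_le_one_of_le₀ hr1 (by linarith))
  refine Real.sSup_le ?_ (by positivity)
  rintro _ ⟨x, hx, rfl⟩
  calc quadSum G x ≤ (fun i => |x i|) ⬝ᵥ (G.adjMatrix ℝ *ᵥ fun i => |x i|) :=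
        quadSum_le_dotProduct_abs G x
    _ ≤ (1 - 1 / (r : ℝ)) * (∑ i, |x i|) ^ 2 := motzkin_straus G hr hG _ fun _ => abs_nonneg _
    _ ≤ _ := mul_le_mul_of_nonneg_left (sq_sum_abs_le_card_rpow hα hx) hcoef
end

section
/- Let α ≥ 1 be a real number, k ≥ 1 an integer, and let G₁ and G₂ be finite simple graphs on the same vertex set of size n. If the edge sets of G₁ and G₂ differ in at most k edges (i.e., the symmetric difference of their edge sets has size at most k), then |λ^(α)(G₁) − λ^(α)(G₂)| ≤ (2k)^{1 − 1/α}. -/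
open Filter

open Classical in
/-- The ordered pairs of vertices that are adjacent in exactly one of `G₁` and `G₂`. -/
noncomputable def diffPairs {n : ℕ} (G₁ G₂ : SimpleGraph (Fin n)) : Finset (Fin n × Fin n) :=
  {p | ¬(G₁.Adj p.1 p.2 ↔ G₂.Adj p.1 p.2)}

theorem card_diffPairs_le {n : ℕ} (G₁ G₂ : SimpleGraph (Fin n)) :
    (diffPairs G₁ G₂).card ≤ 2 * (symmDiff G₁.edgeSet G₂.edgeSet).ncard := by
  classical
  rw [Set.ncard_eq_toFinset_card']
  refine Finset.card_le_mul_card_image_of_maps_to (f := fun p : Fin n × Fin n => s(p.1, p.2)) ?_ 2 ?_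
  · rintro ⟨u, v⟩ h
    simp only [diffPairs, Finset.mem_filter] at h
    simp only [Set.mem_toFinset, Set.mem_symmDiff, SimpleGraph.mem_edgeSet]
    tauto
  · intro e _
    induction e with
    | _ a b =>
      refine (Finset.card_le_card (t := {(a, b), (b, a)}) ?_).trans Finset.card_le_two
      rintro ⟨u, v⟩ h
      simp only [Finset.mem_filter, Sym2.eq_iff] at h
      simp only [Finset.mem_insert, Finset.mem_singleton, Prod.mk.injEq]
      exact h.2

theorem abs_quadSum_sub_le_sum {n : ℕ} (G₁ G₂ : SimpleGraph (Fin n)) (x : Fin n → ℝ) :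
    |quadSum G₁ x - quadSum G₂ x| ≤ ∑ p ∈ diffPairs G₁ G₂, |x p.1 * x p.2| := by
  classical
  rw [diffPairs, Finset.sum_filter, Fintype.sum_prod_type, quadSum, quadSum,
    ← Finset.sum_sub_distrib]
  refine (Finset.abs_sum_le_sum_abs _ _).trans (Finset.sum_le_sum fun u _ => ?_)
  rw [← Finset.sum_sub_distrib]
  refine (Finset.abs_sum_le_sum_abs _ _).trans (Finset.sum_le_sum fun v _ => ?_)
  by_cases h₁ : G₁.Adj u v <;> by_cases h₂ : G₂.Adj u v <;> simp [h₁, h₂]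

theorem sum_abs_mul_le_card_rpow {n : ℕ} {α : ℝ} (hα : 1 ≤ α) {x : Fin n → ℝ}
    (hx : ∑ i, |x i| ^ α = 1) (D : Finset (Fin n × Fin n)) :
    ∑ p ∈ D, |x p.1 * x p.2| ≤ (D.card : ℝ) ^ (1 - 1 / α) := by
  have hα₀ : 0 < α := by linarith
  have hsum : ∑ p ∈ D, |x p.1 * x p.2| ^ α ≤ 1 := by
    calc ∑ p ∈ D, |x p.1 * x p.2| ^ α
        ≤ ∑ p : Fin n × Fin n, |x p.1 * x p.2| ^ α :=
          Finset.sum_le_sum_of_subset_of_nonneg (Finset.subset_univ D) fun _ _ _ => by positivity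
      _ = (∑ i, |x i| ^ α) * ∑ i, |x i| ^ α := by
          rw [Finset.sum_mul_sum, Fintype.sum_prod_type]
          simp only [abs_mul, Real.mul_rpow (abs_nonneg _) (abs_nonneg _)]
      _ = 1 := by rw [hx, one_mul]
  have hpow : (∑ p ∈ D, |x p.1 * x p.2|) ^ α ≤ (D.card : ℝ) ^ (α - 1) :=
    (Real.rpow_sum_le_const_mul_sum_rpow D _ hα).trans
      (mul_le_of_le_one_right (by positivity) hsum)
  rw [← Real.rpow_le_rpow_iff (Finset.sum_nonneg fun _ _ => abs_nonneg _) (by positivity) hα₀,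
    ← Real.rpow_mul (by positivity)]
  convert hpow using 2
  field_simp

theorem abs_quadSum_sub_le {n : ℕ} {α : ℝ} (hα : 1 ≤ α) {x : Fin n → ℝ}
    (hx : ∑ i, |x i| ^ α = 1) (G₁ G₂ : SimpleGraph (Fin n)) :
    |quadSum G₁ x - quadSum G₂ x| ≤
      (2 * ((symmDiff G₁.edgeSet G₂.edgeSet).ncard : ℝ)) ^ (1 - 1 / α) := by
  refine (abs_quadSum_sub_le_sum G₁ G₂ x).trans ((sum_abs_mul_le_card_rpow hα hx _).trans ?_)
  refine Real.rpow_le_rpow (by positivity) (by exact_mod_cast card_diffPairs_le G₁ G₂) ?_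
  rw [sub_nonneg, div_le_one (by linarith)]
  exact hα

theorem bddAbove_quadSum {n : ℕ} {α : ℝ} (hα : 1 ≤ α) (G : SimpleGraph (Fin n)) :
    BddAbove {y | ∃ x : Fin n → ℝ, (∑ i, |x i| ^ α) = 1 ∧ y = quadSum G x} := by
  refine ⟨(2 * ((symmDiff G.edgeSet (⊥ : SimpleGraph (Fin n)).edgeSet).ncard : ℝ)) ^ (1 - 1 / α),
    ?_⟩
  rintro _ ⟨x, hx, rfl⟩
  have h := (le_abs_self _).trans (abs_quadSum_sub_le hα hx G ⊥)
  simpa only [quadSum, SimpleGraph.bot_adj, if_false, Finset.sum_const_zero, sub_zero] using h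

theorem lambdaA_le_add {n : ℕ} {α C : ℝ} (hα : 1 ≤ α) (hC : 0 ≤ C) {G₁ G₂ : SimpleGraph (Fin n)}
    (h : ∀ x : Fin n → ℝ, ∑ i, |x i| ^ α = 1 → |quadSum G₁ x - quadSum G₂ x| ≤ C) :
    lambdaA α G₁ ≤ lambdaA α G₂ + C := by
  by_cases hne : ∃ x : Fin n → ℝ, ∑ i, |x i| ^ α = 1
  · obtain ⟨x₀, hx₀⟩ := hne
    refine csSup_le ⟨_, x₀, hx₀, rfl⟩ ?_
    rintro _ ⟨x, hx, rfl⟩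
    have hle : quadSum G₂ x ≤ lambdaA α G₂ := le_csSup (bddAbove_quadSum hα G₂) ⟨x, hx, rfl⟩
    linarith [(abs_le.1 (h x hx)).2]
  · have hzero (G : SimpleGraph (Fin n)) : lambdaA α G = 0 := by
      have hempty : {y | ∃ x : Fin n → ℝ, (∑ i, |x i| ^ α) = 1 ∧ y = quadSum G x} = ∅ :=
        Set.eq_empty_of_forall_notMem fun _ ⟨x, hx, _⟩ => hne ⟨x, hx⟩
      rw [lambdaA, hempty, Real.sSup_empty]
    simpa [hzero] using hC

/-- For `α ≥ 1` and `k ≥ 1`, if `G₁` and `G₂` are graphs on the same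
vertex set whose edge sets differ in at most `k` edges, then
`|λ^(α)(G₁) − λ^(α)(G₂)| ≤ (2k)^{1 − 1/α}`. -/
theorem lambdaA_sub_le_of_symmDiff (α : ℝ) (hα : 1 ≤ α) (k n : ℕ) (hk : 1 ≤ k)
    (G₁ G₂ : SimpleGraph (Fin n))
    (hdiff : (symmDiff G₁.edgeSet G₂.edgeSet).ncard ≤ k) :
    |lambdaA α G₁ - lambdaA α G₂| ≤ (2 * (k : ℝ)) ^ (1 - 1 / α) := by
  have hC (x : Fin n → ℝ) (hx : ∑ i, |x i| ^ α = 1) :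
      |quadSum G₁ x - quadSum G₂ x| ≤ (2 * (k : ℝ)) ^ (1 - 1 / α) := by
    refine (abs_quadSum_sub_le hα hx G₁ G₂).trans (Real.rpow_le_rpow (by positivity) ?_ ?_)
    · gcongr
    · rw [sub_nonneg, div_le_one (by linarith)]
      exact hα
  have h₁ := lambdaA_le_add hα (by positivity) hC
  have h₂ := lambdaA_le_add (G₁ := G₂) (G₂ := G₁) hα (by positivity)
    fun x hx => abs_sub_comm (quadSum G₂ x) (quadSum G₁ x) ▸ hC x hx
  rw [abs_le]
  constructor <;> linarith
end
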